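/- arXiv:1008.2716 — 4 statements merged into one kernel-verified Lean document; each statement's English description precedes it below -/
import Mathlib

section
/- Let C be a nonzero Weyl candidate on n-dimensional Minkowski vector space with superenergy tensor 𝒯, and let ℓ be a causal vector. Then 𝒯_{αβλμ}ℓ^α = 0 for all β,λ,μ if and only if the antisymmetrization of ℓ_β C_{αρσλ} over the index triple (β,α,ρ) vanishes identically. Moreover, if either condition holds then ℓ is necessarily null. -/
open Finset

noncomputable section

/-- Sign of the `i`-th diagonal entry of the Minkowski metric diag(-1,1,...,1). -/
def sgn {n : ℕ} (i : Fin n) : ℝ := if (i : ℕ) = 0 then -1 else 1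

/-- The Minkowski metric components η_{ij} (= η^{ij}). -/
def eta {n : ℕ} (i j : Fin n) : ℝ := if i = j then sgn i else 0

/-- Minkowski square η(v,v) of a vector. -/
def mSq {n : ℕ} (v : Fin n → ℝ) : ℝ := ∑ i, sgn i * v i * v i

/-- Lowered components v_i = η_{ij} v^j. -/
def lo {n : ℕ} (v : Fin n → ℝ) (i : Fin n) : ℝ := sgn i * v i

/-- A Weyl candidate: the index symmetries of the Weyl tensor plus tracelessness. -/
def IsWeyl {n : ℕ} (C : Fin n → Fin n → Fin n → Fin n → ℝ) : Prop :=
  (∀ a b l m, C b a l m = - C a b l m) ∧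
  (∀ a b l m, C a b m l = - C a b l m) ∧
  (∀ a b l m, C a b l m = C l m a b) ∧
  (∀ a b l m, C a b l m + C a l m b + C a m b l = 0) ∧
  (∀ b m, ∑ a, sgn a * C a b a m = 0)

/-- The superenergy (generalized Bel–Robinson) tensor of a Weyl candidate. -/
def SE {n : ℕ} (C : Fin n → Fin n → Fin n → Fin n → ℝ) (a b l m : Fin n) : ℝ :=
  (∑ r, ∑ s, sgn r * sgn s * (C a r l s * C b r m s + C a r m s * C b r l s))
  - (1/2) * eta a b * (∑ r, ∑ t, ∑ s, sgn r * sgn t * sgn s * C r t l s * C r t m s)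
  - (1/2) * eta l m * (∑ r, ∑ s, ∑ t, sgn r * sgn s * sgn t * C a r s t * C b r s t)
  + (1/8) * eta a b * eta l m *
      (∑ r, ∑ t, ∑ s, ∑ v, sgn r * sgn t * sgn s * sgn v * C r t s v * C r t s v)

theorem sgn_mul_self {n : ℕ} (i : Fin n) : sgn i * sgn i = 1 := by
  unfold sgn; split_ifs <;> norm_num

theorem sgn_zero {n : ℕ} [NeZero n] : sgn (0 : Fin n) = -1 := by
  simp [sgn]

theorem sgn_mul_lo {n : ℕ} (v : Fin n → ℝ) (i : Fin n) : sgn i * lo v i = v i := by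
  rw [lo, ← mul_assoc, sgn_mul_self, one_mul]

/-- A Lorentzian sum is the Euclidean sum minus twice the time component. -/
theorem sum_sgn_mul {n : ℕ} [NeZero n] (f : Fin n → ℝ) :
    ∑ i, sgn i * f i = ∑ i, f i - 2 * f 0 := by
  have h : ∀ i : Fin n, sgn i * f i = f i - if i = 0 then 2 * f i else 0 := by
    intro i
    by_cases hi : i = 0
    · subst hi; simp only [sgn_zero, if_true]; ring
    · have : (i : ℕ) ≠ 0 := fun h => hi (Fin.ext h)
      simp [sgn, this, hi]
  simp only [h, sum_sub_distrib, sum_ite_eq', mem_univ, if_true]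

theorem sum_sgn_mul_of_eq_zero {n : ℕ} [NeZero n] (f : Fin n → ℝ) (hf : f 0 = 0) :
    ∑ i, sgn i * f i = ∑ i, f i := by
  rw [sum_sgn_mul, hf]; ring

theorem eta_eq {n : ℕ} (i j : Fin n) : eta i j = if i = j then sgn j else 0 := by
  unfold eta; split_ifs with h
  · rw [h]
  · rfl

theorem mSq_eq_sum_lo_mul {n : ℕ} (v : Fin n → ℝ) : mSq v = ∑ i, v i * lo v i := by
  unfold mSq lo; exact sum_congr rfl fun i _ => by ring

theorem mSq_eq_sum_sq_lo {n : ℕ} [NeZero n] (v : Fin n → ℝ) :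
    mSq v = ∑ i, lo v i ^ 2 - 2 * lo v 0 ^ 2 := by
  rw [mSq_eq_sum_lo_mul, ← sum_sgn_mul]
  exact sum_congr rfl fun i _ => by rw [← sgn_mul_lo v i]; ring

theorem lo_zero_ne_zero {n : ℕ} [NeZero n] {v : Fin n → ℝ} (hv : v ≠ 0) (hc : mSq v ≤ 0) :
    lo v 0 ≠ 0 := by
  intro h0
  rw [mSq_eq_sum_sq_lo, h0] at hc
  have hs : ∑ i, lo v i ^ 2 = 0 :=
    le_antisymm (by linarith) (sum_nonneg fun i _ => sq_nonneg _)
  apply hv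
  ext i
  have := (sum_eq_zero_iff_of_nonneg fun i _ => sq_nonneg (lo v i)).1 hs i (mem_univ i)
  rw [← sgn_mul_lo v i, pow_eq_zero_iff two_ne_zero |>.1 this, mul_zero]; rfl

/-- The Lorentzian contraction of two 2-forms in terms of Euclidean ones. -/
theorem four_sum_add_sum_sgn_mul {n : ℕ} [NeZero n] {X Y : Fin n → Fin n → ℝ}
    (hX : ∀ i j, X j i = - X i j) (hY : ∀ i j, Y j i = - Y i j) :
    4 * ∑ s, sgn s * (X 0 s * Y 0 s) + ∑ s, ∑ t, sgn s * sgn t * (X s t * Y s t)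
      = ∑ s, ∑ t, X s t * Y s t := by
  have h0 : X 0 0 = 0 := by linarith [hX 0 0]
  have h1 : ∀ s, ∑ t, sgn s * sgn t * (X s t * Y s t)
      = sgn s * (∑ t, X s t * Y s t - 2 * (X 0 s * Y 0 s)) := by
    intro s
    rw [show X 0 s * Y 0 s = X s 0 * Y s 0 by rw [hX s 0, hY s 0]; ring, ← sum_sgn_mul, mul_sum]
    exact sum_congr rfl fun t _ => by ring
  simp only [h1]
  rw [sum_sgn_mul, sum_sgn_mul, sum_sub_distrib, ← mul_sum, h0]
  ring

/-- The superenergy (Maxwell energy-momentum) tensor of a 2-form. -/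
def formSE {n : ℕ} (F : Fin n → Fin n → ℝ) (a b : Fin n) : ℝ :=
  ∑ r, sgn r * (F a r * F b r) - (1/4) * eta a b * ∑ r, ∑ t, sgn r * sgn t * (F r t * F r t)

/-- The wedge product of a covector and a 2-form. -/
def wedge {n : ℕ} (p : Fin n → ℝ) (F : Fin n → Fin n → ℝ) (i j k : Fin n) : ℝ :=
  p i * F j k + p j * F k i + p k * F i j

theorem sum_formSE_mul {n : ℕ} [NeZero n] {F : Fin n → Fin n → ℝ}
    (hF : ∀ i j, F j i = - F i j) (v : Fin n → ℝ) :
    -4 * lo v 0 * ∑ a, formSE F a 0 * v a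
      = ∑ i, ∑ j, wedge (lo v) F 0 i j ^ 2 - 2 * mSq v * ∑ i, F 0 i ^ 2
        + 2 * (∑ i, lo v i * F 0 i) ^ 2 := by
  have h0 : F 0 0 = 0 := by linarith [hF 0 0]
  rw [mSq_eq_sum_sq_lo]
  have hQ : ∑ r, ∑ t, sgn r * sgn t * (F r t * F r t)
      = ∑ i, ∑ j, F i j ^ 2 - 4 * ∑ i, F 0 i ^ 2 := by
    have := four_sum_add_sum_sgn_mul hF hF
    rw [sum_sgn_mul_of_eq_zero _ (by simp [h0])] at this
    simp only [sq]
    linarith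
  have hT : ∑ a, formSE F a 0 * v a = ∑ i, ∑ j, lo v i * F i j * F 0 j
      - lo v 0 * ∑ i, F 0 i ^ 2 - lo v 0 / 4 * ∑ i, ∑ j, F i j ^ 2 := by
    have h1 : ∀ a, formSE F a 0 * v a = sgn a * (∑ j, lo v a * F a j * F 0 j)
        - (if a = 0 then (1/4) * lo v 0 * (∑ i, ∑ j, F i j ^ 2 - 4 * ∑ i, F 0 i ^ 2) else 0) := by
      intro a
      rw [formSE, sum_sgn_mul_of_eq_zero _ (by simp [h0]), hQ, eta_eq, ← sgn_mul_lo v a]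
      have : ∑ j, lo v a * F a j * F 0 j = lo v a * ∑ j, F a j * F 0 j := by
        rw [mul_sum]; exact sum_congr rfl fun j _ => by ring
      rw [this]
      split_ifs with h
      · subst h; rw [sgn_zero]; ring
      · ring
    simp only [h1, sum_sub_distrib, sum_ite_eq', mem_univ, if_true]
    rw [sum_sgn_mul]
    have : ∑ j, lo v 0 * F 0 j * F 0 j = lo v 0 * ∑ i, F 0 i ^ 2 := by
      rw [mul_sum]; exact sum_congr rfl fun j _ => by ring
    rw [this]; ring
  have hW : ∑ i, ∑ j, wedge (lo v) F 0 i j ^ 2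
      = lo v 0 ^ 2 * ∑ i, ∑ j, F i j ^ 2
        + 2 * ((∑ i, lo v i ^ 2) * ∑ i, F 0 i ^ 2) - 2 * (∑ i, lo v i * F 0 i) ^ 2
        - 4 * lo v 0 * ∑ i, ∑ j, lo v i * F i j * F 0 j := by
    have hswap : ∑ i, ∑ j, lo v j * F j i * F 0 i = ∑ i, ∑ j, lo v i * F i j * F 0 j := sum_comm
    have hswap' : ∑ i, ∑ j, lo v j ^ 2 * F 0 i ^ 2 = ∑ i, ∑ j, lo v i ^ 2 * F 0 j ^ 2 := sum_comm
    have h1 : ∀ i j, wedge (lo v) F 0 i j ^ 2 = lo v 0 ^ 2 * F i j ^ 2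
        + lo v i ^ 2 * F 0 j ^ 2 + lo v j ^ 2 * F 0 i ^ 2
        - 2 * ((lo v i * F 0 i) * (lo v j * F 0 j))
        - 2 * lo v 0 * (lo v i * F i j * F 0 j) - 2 * lo v 0 * (lo v j * F j i * F 0 i) := by
      intro i j
      rw [wedge, hF 0 j, hF i j]; ring
    simp only [h1, sum_sub_distrib, sum_add_distrib, ← mul_sum, hswap, hswap']
    rw [sq (∑ i, lo v i * F 0 i), sum_mul_sum, sum_mul_sum]
    simp only [← mul_sum]
    ring
  rw [hT, hW]; ring

theorem sum_formSE_mul_nonneg {n : ℕ} [NeZero n] {F : Fin n → Fin n → ℝ}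
    (hF : ∀ i j, F j i = - F i j) {v : Fin n → ℝ} (hc : mSq v ≤ 0) :
    0 ≤ -4 * lo v 0 * ∑ a, formSE F a 0 * v a := by
  rw [sum_formSE_mul hF]
  have h1 : 0 ≤ ∑ i, ∑ j, wedge (lo v) F 0 i j ^ 2 :=
    sum_nonneg fun i _ => sum_nonneg fun j _ => sq_nonneg _
  have h2 : 0 ≤ ∑ i, F 0 i ^ 2 := sum_nonneg fun i _ => sq_nonneg _
  nlinarith [mul_nonneg (neg_nonneg.2 hc) h2, sq_nonneg (∑ i, lo v i * F 0 i)]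

theorem wedge_eq_zero_of_sum_formSE_mul_eq_zero {n : ℕ} [NeZero n] {F : Fin n → Fin n → ℝ}
    (hF : ∀ i j, F j i = - F i j) {v : Fin n → ℝ} (hv : v ≠ 0) (hc : mSq v ≤ 0)
    (h : ∑ a, formSE F a 0 * v a = 0) (i j k : Fin n) : wedge (lo v) F i j k = 0 := by
  have hp := lo_zero_ne_zero hv hc
  have key := sum_formSE_mul hF v
  rw [h, mul_zero] at key
  have h1 : 0 ≤ ∑ i, ∑ j, wedge (lo v) F 0 i j ^ 2 :=
    sum_nonneg fun i _ => sum_nonneg fun j _ => sq_nonneg _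
  have h2 : 0 ≤ ∑ i, F 0 i ^ 2 := sum_nonneg fun i _ => sq_nonneg _
  have h3 : ∑ i, ∑ j, wedge (lo v) F 0 i j ^ 2 = 0 := by
    nlinarith [mul_nonneg (neg_nonneg.2 hc) h2, sq_nonneg (∑ i, lo v i * F 0 i)]
  have h4 : ∀ i j, wedge (lo v) F 0 i j = 0 := by
    intro i j
    have hi := (sum_eq_zero_iff_of_nonneg
      fun i _ => sum_nonneg fun j _ => sq_nonneg (wedge (lo v) F 0 i j)).1 h3 i (mem_univ i)
    have hj := (sum_eq_zero_iff_of_nonneg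
      fun j _ => sq_nonneg (wedge (lo v) F 0 i j)).1 hi j (mem_univ j)
    exact pow_eq_zero_iff two_ne_zero |>.1 hj
  apply mul_left_cancel₀ hp
  have hij := h4 i j
  have hjk := h4 j k
  have hki := h4 k i
  simp only [wedge] at hij hjk hki ⊢
  rw [hF 0 j] at hij
  rw [hF 0 k] at hjk
  rw [hF 0 i] at hki
  linear_combination lo v i * hjk + lo v j * hki + lo v k * hij

theorem SE_zero_zero {n : ℕ} [NeZero n] {C : Fin n → Fin n → Fin n → Fin n → ℝ}
    (hC : ∀ a b l m, C a b m l = - C a b l m) (a b : Fin n) :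
    SE C a b 0 0 = (1/2) * ∑ s, ∑ t, formSE (fun i j => C i j s t) a b := by
  have hS : ∑ s, ∑ t, formSE (fun i j => C i j s t) a b
      = ∑ r, sgn r * (∑ s, ∑ t, C a r s t * C b r s t)
        - (1/4) * eta a b * ∑ r, ∑ u, sgn r * sgn u * (∑ s, ∑ t, C r u s t * C r u s t) := by
    simp only [formSE, sum_sub_distrib, ← mul_sum]
    congr 1
    · simp only [mul_sum]
      rw [sum_congr rfl fun s _ => sum_comm, sum_comm]
    · congr 1
      simp only [mul_sum]
      rw [sum_congr rfl fun s _ => sum_comm, sum_comm]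
      refine sum_congr rfl fun r _ => ?_
      rw [sum_congr rfl fun s _ => sum_comm, sum_comm]
  rw [hS]
  have h1 : ∑ r, ∑ s, sgn r * sgn s * (C a r 0 s * C b r 0 s + C a r 0 s * C b r 0 s)
      = 2 * ∑ r, sgn r * ∑ s, sgn s * (C a r 0 s * C b r 0 s) := by
    simp only [mul_sum]
    exact sum_congr rfl fun r _ => sum_congr rfl fun s _ => by ring
  have h2 : ∑ r, ∑ u, ∑ s, sgn r * sgn u * sgn s * C r u 0 s * C r u 0 s
      = ∑ r, ∑ u, sgn r * sgn u * ∑ s, sgn s * (C r u 0 s * C r u 0 s) := by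
    simp only [mul_sum]
    exact sum_congr rfl fun r _ => sum_congr rfl fun u _ => sum_congr rfl fun s _ => by ring
  have h3 : ∑ r, ∑ s, ∑ t, sgn r * sgn s * sgn t * C a r s t * C b r s t
      = ∑ r, sgn r * ∑ s, ∑ t, sgn s * sgn t * (C a r s t * C b r s t) := by
    simp only [mul_sum]
    exact sum_congr rfl fun r _ => sum_congr rfl fun s _ => sum_congr rfl fun t _ => by ring
  have h4 : ∑ r, ∑ u, ∑ s, ∑ t, sgn r * sgn u * sgn s * sgn t * C r u s t * C r u s t
      = ∑ r, ∑ u, sgn r * sgn u * ∑ s, ∑ t, sgn s * sgn t * (C r u s t * C r u s t) := by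
    simp only [mul_sum]
    exact sum_congr rfl fun r _ => sum_congr rfl fun u _ => sum_congr rfl fun s _ =>
      sum_congr rfl fun t _ => by ring
  have h5 : ∑ r, sgn r * (∑ s, ∑ t, C a r s t * C b r s t)
      = 4 * ∑ r, sgn r * ∑ s, sgn s * (C a r 0 s * C b r 0 s)
        + ∑ r, sgn r * ∑ s, ∑ t, sgn s * sgn t * (C a r s t * C b r s t) := by
    rw [mul_sum, ← sum_add_distrib]
    refine sum_congr rfl fun r _ => ?_
    rw [← four_sum_add_sum_sgn_mul (hC a r) (hC b r)]; ring
  have h6 : ∑ r, ∑ u, sgn r * sgn u * (∑ s, ∑ t, C r u s t * C r u s t)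
      = 4 * ∑ r, ∑ u, sgn r * sgn u * ∑ s, sgn s * (C r u 0 s * C r u 0 s)
        + ∑ r, ∑ u, sgn r * sgn u * ∑ s, ∑ t, sgn s * sgn t * (C r u s t * C r u s t) := by
    rw [mul_sum, ← sum_add_distrib]
    refine sum_congr rfl fun r _ => ?_
    rw [mul_sum, ← sum_add_distrib]
    refine sum_congr rfl fun u _ => ?_
    rw [← four_sum_add_sum_sgn_mul (hC r u) (hC r u)]; ring
  rw [SE, h1, h2, h3, h4, h5, h6, show eta (0 : Fin n) 0 = -1 by rw [eta, if_pos rfl, sgn_zero]]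
  ring

theorem sum_perm_eq_wedge {n : ℕ} {v : Fin n → ℝ} {F : Fin n → Fin n → ℝ}
    (hF : ∀ i j, F j i = - F i j) (p : Fin 3 → Fin n) :
    ∑ σ : Equiv.Perm (Fin 3), ((Equiv.Perm.sign σ : ℤ) : ℝ) *
      (v (p (σ 0)) * F (p (σ 1)) (p (σ 2))) = 2 * wedge v F (p 0) (p 1) (p 2) := by
  have huniv : (univ : Finset (Equiv.Perm (Fin 3))) =
      {1, Equiv.swap 0 1, Equiv.swap 0 2, Equiv.swap 1 2, Equiv.swap 0 1 * Equiv.swap 1 2,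
        Equiv.swap 1 2 * Equiv.swap 0 1} := by decide
  rw [huniv, sum_insert (by decide), sum_insert (by decide), sum_insert (by decide),
    sum_insert (by decide), sum_insert (by decide), sum_singleton]
  have e1 : Equiv.swap (0 : Fin 3) 1 2 = 2 := by decide
  have e2 : Equiv.swap (0 : Fin 3) 2 1 = 1 := by decide
  have e3 : Equiv.swap (1 : Fin 3) 2 0 = 0 := by decide
  have s1 : Equiv.Perm.sign (Equiv.swap (0 : Fin 3) 1) = -1 := by decide
  have s2 : Equiv.Perm.sign (Equiv.swap (0 : Fin 3) 2) = -1 := by decide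
  have s3 : Equiv.Perm.sign (Equiv.swap (1 : Fin 3) 2) = -1 := by decide
  simp only [Equiv.Perm.sign_mul, Equiv.Perm.sign_one, s1, s2, s3, Equiv.Perm.mul_apply,
    Equiv.Perm.one_apply, Equiv.swap_apply_left, Equiv.swap_apply_right, e1, e2, e3, wedge]
  rw [hF (p 0) (p 1), hF (p 1) (p 2), hF (p 2) (p 0)]
  push_cast
  ring

/-- A nonzero causal vector whose contraction with the superenergy tensor vanishes has
vanishing wedge product with the tensor. -/
theorem wedge_eq_zero_of_sum_SE_mul_eq_zero {n : ℕ} [NeZero n]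
    {C : Fin n → Fin n → Fin n → Fin n → ℝ}
    (h₁ : ∀ a b l m, C b a l m = - C a b l m) (h₂ : ∀ a b l m, C a b m l = - C a b l m)
    {v : Fin n → ℝ} (hv : v ≠ 0) (hc : mSq v ≤ 0) (h : ∑ a, SE C a 0 0 0 * v a = 0)
    (s t i j k : Fin n) : wedge (lo v) (fun i j => C i j s t) i j k = 0 := by
  have hsum : ∑ s, ∑ t, -4 * lo v 0 * ∑ a, formSE (fun i j => C i j s t) a 0 * v a = 0 := by
    simp only [← mul_sum]
    rw [mul_eq_zero]; right
    rw [sum_congr rfl fun s _ => sum_comm, sum_comm]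
    simp only [← sum_mul]
    simp only [SE_zero_zero h₂, mul_assoc, ← mul_sum] at h
    simpa using h
  have hnn : ∀ s t, 0 ≤ -4 * lo v 0 * ∑ a, formSE (fun i j => C i j s t) a 0 * v a :=
    fun s t => sum_formSE_mul_nonneg (fun i j => h₁ i j s t) hc
  have hs := (sum_eq_zero_iff_of_nonneg fun s _ => sum_nonneg fun t _ => hnn s t).1 hsum s
    (mem_univ s)
  have hst := (sum_eq_zero_iff_of_nonneg fun t _ => hnn s t).1 hs t (mem_univ t)
  refine wedge_eq_zero_of_sum_formSE_mul_eq_zero (fun i j => h₁ i j s t) hv hc ?_ i j k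
  have hp := lo_zero_ne_zero hv hc
  simpa [hp] using hst

theorem IsWeyl.sum_mul_eq_zero {n : ℕ} {C : Fin n → Fin n → Fin n → Fin n → ℝ}
    (hC : IsWeyl C) {v : Fin n → ℝ}
    (h : ∀ s t i j k, wedge (lo v) (fun i j => C i j s t) i j k = 0) (r s t : Fin n) :
    ∑ a, v a * C a r s t = 0 := by
  obtain ⟨h₁, h₂, h₃, -, h₅⟩ := hC
  have key : ∑ a, sgn a * wedge (lo v) (fun i j => C i j a r) s a t = 0 :=
    sum_eq_zero fun a _ => by rw [h, mul_zero]
  have e : ∀ a, sgn a * wedge (lo v) (fun i j => C i j a r) s a t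
      = lo v s * (sgn a * C a t a r) - v a * C a r s t - lo v t * (sgn a * C a s a r) := by
    intro a
    rw [wedge, ← sgn_mul_lo v a, h₃ a r s t, h₁ s t a r, h₁ a s a r]; ring
  simp only [e, sum_sub_distrib, ← mul_sum, h₅] at key
  linarith

theorem mSq_mul_eq_zero {n : ℕ} {F : Fin n → Fin n → ℝ} (hF : ∀ i j, F j i = - F i j)
    {v : Fin n → ℝ} (hv : ∀ r, ∑ a, v a * F a r = 0)
    (h : ∀ i j k, wedge (lo v) F i j k = 0) (i j : Fin n) : mSq v * F i j = 0 := by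
  have key : ∑ a, v a * wedge (lo v) F a i j = 0 :=
    sum_eq_zero fun a _ => by rw [h, mul_zero]
  have e : ∀ a, v a * wedge (lo v) F a i j
      = v a * lo v a * F i j - lo v i * (v a * F a j) + lo v j * (v a * F a i) := by
    intro a
    rw [wedge, hF a j]; ring
  simp only [e, sum_sub_distrib, sum_add_distrib, ← mul_sum, hv, ← sum_mul] at key
  rw [mSq_eq_sum_lo_mul]; linarith

theorem sum_sgn_mul_eq_zero_of_wedge {n : ℕ} {F G : Fin n → Fin n → ℝ}
    (hG : ∀ i j, G j i = - G i j) {v : Fin n → ℝ} {k : Fin n} (hk : lo v k ≠ 0)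
    (hv : ∀ r, ∑ a, v a * G a r = 0) (h : ∀ i j k, wedge (lo v) F i j k = 0) :
    ∑ r, ∑ t, sgn r * sgn t * (F r t * G r t) = 0 := by
  apply mul_left_cancel₀ hk
  have e : ∀ r t, lo v k * (sgn r * sgn t * (F r t * G r t))
      = sgn r * F k r * (v t * G t r) - sgn t * F t k * (v r * G r t) := by
    intro r t
    have := h k r t
    rw [wedge] at this
    rw [← sgn_mul_lo v r, ← sgn_mul_lo v t, hG r t]
    linear_combination sgn r * sgn t * G r t * this
  simp only [mul_sum, e, sum_sub_distrib]
  rw [sum_comm (f := fun r t => sgn t * F t k * (v r * G r t))]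
  simp only [← mul_sum, hv, mul_zero, sum_const_zero, sub_zero]

theorem sum_SE_mul_eq_zero {n : ℕ} {C : Fin n → Fin n → Fin n → Fin n → ℝ}
    {v : Fin n → ℝ} (hv : ∀ r s t, ∑ a, v a * C a r s t = 0)
    (hsq : ∀ s t s' t', ∑ r, ∑ u, sgn r * sgn u * (C r u s t * C r u s' t') = 0)
    (b l m : Fin n) : ∑ a, SE C a b l m * v a = 0 := by
  have h2 : ∑ r, ∑ t, ∑ s, sgn r * sgn t * sgn s * C r t l s * C r t m s = 0 := by
    rw [sum_congr rfl fun r _ => sum_comm, sum_comm]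
    refine sum_eq_zero fun s _ => ?_
    rw [← mul_zero (sgn s), ← hsq l s m s]
    simp only [mul_sum]
    exact sum_congr rfl fun r _ => sum_congr rfl fun t _ => by ring
  have h4 : ∑ r, ∑ t, ∑ s, ∑ u, sgn r * sgn t * sgn s * sgn u * C r t s u * C r t s u = 0 := by
    rw [sum_congr rfl fun r _ => sum_comm, sum_comm]
    refine sum_eq_zero fun s _ => ?_
    rw [sum_congr rfl fun r _ => sum_comm, sum_comm]
    refine sum_eq_zero fun u _ => ?_
    rw [← mul_zero (sgn s * sgn u), ← hsq s u s u]
    simp only [mul_sum]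
    exact sum_congr rfl fun r _ => sum_congr rfl fun t _ => by ring
  have h1 : ∑ a, ∑ r, ∑ s, sgn r * sgn s * (C a r l s * C b r m s + C a r m s * C b r l s) * v a
      = 0 := by
    rw [sum_comm]
    refine sum_eq_zero fun r _ => ?_
    rw [sum_comm]
    refine sum_eq_zero fun s _ => ?_
    have e : ∀ a, sgn r * sgn s * (C a r l s * C b r m s + C a r m s * C b r l s) * v a
        = sgn r * sgn s * C b r m s * (v a * C a r l s)
          + sgn r * sgn s * C b r l s * (v a * C a r m s) := fun a => by ring
    simp only [e, sum_add_distrib, ← mul_sum, hv, mul_zero, add_zero]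
  have h3 : ∑ a, ∑ r, ∑ s, ∑ t, sgn r * sgn s * sgn t * C a r s t * C b r s t * v a = 0 := by
    rw [sum_comm]
    refine sum_eq_zero fun r _ => ?_
    rw [sum_comm]
    refine sum_eq_zero fun s _ => ?_
    rw [sum_comm]
    refine sum_eq_zero fun t _ => ?_
    rw [← mul_zero (sgn r * sgn s * sgn t * C b r s t), ← hv r s t, mul_sum]
    exact sum_congr rfl fun a _ => by ring
  simp only [← sum_mul] at h1 h3
  have e : ∀ a, SE C a b l m * v a
      = (∑ r, ∑ s, sgn r * sgn s * (C a r l s * C b r m s + C a r m s * C b r l s)) * v a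
        - (1/2) * eta l m *
          ((∑ r, ∑ s, ∑ t, sgn r * sgn s * sgn t * C a r s t * C b r s t) * v a) := by
    intro a
    rw [SE, h2, h4]; ring
  simp only [e, sum_sub_distrib, ← mul_sum, h1, h3, mul_zero, sub_zero]

/-- 𝒯_{αβλμ}ℓ^α = 0 iff the antisymmetrization of ℓ_β C_{αρσλ}
over the triple (β,α,ρ) vanishes; moreover ℓ is then null. -/
theorem stmt_4 {n : ℕ} (hn : 2 ≤ n) (C : Fin n → Fin n → Fin n → Fin n → ℝ)
    (hC : IsWeyl C) (hC0 : C ≠ 0)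
    (ℓ : Fin n → ℝ) (hℓ0 : ℓ ≠ 0) (hcausal : mSq ℓ ≤ 0) :
    ((∀ b l m : Fin n, ∑ a, SE C a b l m * ℓ a = 0) ↔
      (∀ s l : Fin n, ∀ p : Fin 3 → Fin n,
        ∑ σ : Equiv.Perm (Fin 3), ((Equiv.Perm.sign σ : ℤ) : ℝ) *
          (lo ℓ (p (σ 0)) * C (p (σ 1)) (p (σ 2)) s l) = 0)) ∧
    ((∀ b l m : Fin n, ∑ a, SE C a b l m * ℓ a = 0) → mSq ℓ = 0) := by
  have : NeZero n := ⟨by omega⟩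
  have hperm : ∀ (s t : Fin n) (p : Fin 3 → Fin n),
      ∑ σ : Equiv.Perm (Fin 3), ((Equiv.Perm.sign σ : ℤ) : ℝ) *
        (lo ℓ (p (σ 0)) * C (p (σ 1)) (p (σ 2)) s t)
      = 2 * wedge (lo ℓ) (fun i j => C i j s t) (p 0) (p 1) (p 2) :=
    fun s t p => sum_perm_eq_wedge (fun i j => hC.1 i j s t) p
  have hfwd : (∀ b l m : Fin n, ∑ a, SE C a b l m * ℓ a = 0) →
      ∀ s t i j k, wedge (lo ℓ) (fun i j => C i j s t) i j k = 0 := fun h =>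
    wedge_eq_zero_of_sum_SE_mul_eq_zero hC.1 hC.2.1 hℓ0 hcausal (h 0 0 0)
  refine ⟨⟨fun h s t p => ?_, fun h => ?_⟩, fun h => ?_⟩
  · rw [hperm, hfwd h, mul_zero]
  · have hw : ∀ s t i j k, wedge (lo ℓ) (fun i j => C i j s t) i j k = 0 := by
      intro s t i j k
      have := h s t ![i, j, k]
      rw [hperm] at this
      simpa using this
    have hv := hC.sum_mul_eq_zero hw
    exact sum_SE_mul_eq_zero hv fun s t s' t' =>
      sum_sgn_mul_eq_zero_of_wedge (fun i j => hC.1 i j s' t') (lo_zero_ne_zero hℓ0 hcausal)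
        (fun r => hv r s' t') (hw s t)
  · have hw := hfwd h
    have hv := hC.sum_mul_eq_zero hw
    by_contra hne
    refine hC0 (funext fun i => funext fun j => funext fun s => funext fun t => ?_)
    exact (mul_eq_zero.1 (mSq_mul_eq_zero (fun i j => hC.1 i j s t) (fun r => hv r s t)
      (hw s t) i j)).resolve_left hne
end
end

section
/- Let C be a Weyl candidate on 4-dimensional Minkowski vector space (n = 4) with superenergy tensor 𝒯. Then 𝒯 reduces to the Bel–Robinson form: 𝒯_{αβλμ} = C_{αρλσ}C_β{}^ρ{}_μ{}^σ + C_{αρμσ}C_β{}^ρ{}_λ{}^σ − (1/8)η_{αβ}η_{λμ}C_{ρτσν}C^{ρτσν} for all indices; equivalently, (1/2)η_{αβ}C_{ρτλσ}C^{ρτ}{}_μ{}^σ + (1/2)η_{λμ}C_{αρστ}C_β{}^{ρστ} = (1/4)η_{αβ}η_{λμ}C_{ρτσν}C^{ρτσν}. -/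
open Finset

noncomputable section

/-- The contraction `C_{arst} C_b^{rst}`. -/
def contr (C : Fin 4 → Fin 4 → Fin 4 → Fin 4 → ℝ) (a b : Fin 4) : ℝ :=
  ∑ r, ∑ s, ∑ t, sgn r * sgn s * sgn t * C a r s t * C b r s t

/-- In dimension four, `C_{arst} C_b^{rst}` is a pure trace. -/
theorem contr_eq_eta_mul (C : Fin 4 → Fin 4 → Fin 4 → Fin 4 → ℝ) (hC : IsWeyl C) (a b : Fin 4) :
    contr C a b = -eta a b * contr C 0 0 := by
  obtain ⟨skew₁, skew₂, pair, bianchi, trace⟩ := hC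
  have diag₁ (i l m) : C i i l m = 0 := by linarith [skew₁ i i l m]
  have diag₂ (a b i) : C a b i i = 0 := by linarith [skew₂ a b i i]
  simp only [Fin.sum_univ_four, sgn, Fin.val_zero, Fin.val_one, Fin.val_two,
    show ((3 : Fin 4) : ℕ) = 3 from rfl, if_true, one_ne_zero, two_ne_zero, three_ne_zero,
    if_false] at trace
  have t00 := trace 0 0
  have t11 := trace 1 1
  have t22 := trace 2 2
  have t33 := trace 3 3
  have t01 := trace 0 1
  have t02 := trace 0 2
  have t03 := trace 0 3
  have t12 := trace 1 2
  have t13 := trace 1 3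
  have t23 := trace 2 3
  have b0 := bianchi 0 1 2 3
  have s10 := skew₁ 0 1
  have s20 := skew₁ 0 2
  have s30 := skew₁ 0 3
  have s21 := skew₁ 1 2
  have s31 := skew₁ 1 3
  have s32 := skew₁ 2 3
  have r10 (a b) := skew₂ a b 0 1
  have r20 (a b) := skew₂ a b 0 2
  have r30 (a b) := skew₂ a b 0 3
  have r21 (a b) := skew₂ a b 1 2
  have r31 (a b) := skew₂ a b 1 3
  have r32 (a b) := skew₂ a b 2 3
  simp only [diag₁, diag₂, s10, s20, s30, s21, s31, s32, r10, r20, r30, r21, r31, r32]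
    at t00 t11 t22 t33 t01 t02 t03 t12 t13 t23 b0
  have e0 : C 0 3 0 3 = -C 0 1 0 1 - C 0 2 0 2 := by linarith
  have e1 : C 2 3 2 3 = -C 0 1 0 1 := by linarith
  have e2 : C 1 3 1 3 = -C 0 2 0 2 := by linarith
  have e3 : C 1 2 1 2 = C 0 1 0 1 + C 0 2 0 2 := by linarith
  have e4 : C 0 3 1 3 = -C 0 2 1 2 := by linarith
  have e5 : C 0 3 2 3 = C 0 1 1 2 := by linarith
  have e6 : C 0 2 2 3 = -C 0 1 1 3 := by linarith
  have e7 : C 1 3 2 3 = C 0 1 0 2 := by linarith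
  have e8 : C 1 2 2 3 = -C 0 1 0 3 := by linarith
  have e9 : C 1 2 1 3 = C 0 2 0 3 := by linarith
  have e10 : C 0 1 2 3 = C 0 2 1 3 - C 0 3 1 2 := by linarith
  fin_cases a <;> fin_cases b <;>
  · simp [contr, eta, Fin.sum_univ_four, sgn, diag₁, diag₂,
      s10, s20, s30, s21, s31, s32, r10, r20, r30, r21, r31, r32,
      pair 0 2 0 1, pair 0 3 0 1, pair 1 2 0 1, pair 1 3 0 1, pair 2 3 0 1,
      pair 0 3 0 2, pair 1 2 0 2, pair 1 3 0 2, pair 2 3 0 2,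
      pair 1 2 0 3, pair 1 3 0 3, pair 2 3 0 3,
      pair 1 3 1 2, pair 2 3 1 2, pair 2 3 1 3,
      e0, e1, e2, e3, e4, e5, e6, e7, e8, e9, e10]
    try ring

/-- The full contraction of `C` with itself is the trace of `contr C`. -/
theorem sum_sq_eq (C : Fin 4 → Fin 4 → Fin 4 → Fin 4 → ℝ) (hC : IsWeyl C) :
    (∑ r, ∑ t, ∑ s, ∑ v, sgn r * sgn t * sgn s * sgn v * C r t s v * C r t s v)
      = -4 * contr C 0 0 := by
  have h : (∑ r, ∑ t, ∑ s, ∑ v, sgn r * sgn t * sgn s * sgn v * C r t s v * C r t s v)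
      = ∑ r, sgn r * contr C r r := by
    simp only [contr, Finset.mul_sum, mul_assoc]
  rw [h]
  rw [Fin.sum_univ_four]
  rw [contr_eq_eta_mul C hC 1 1, contr_eq_eta_mul C hC 2 2, contr_eq_eta_mul C hC 3 3]
  simp [eta, sgn]
  ring

/-- Pair symmetry identifies the two partial contractions of `C` with itself. -/
theorem sum_pair_eq_contr (C : Fin 4 → Fin 4 → Fin 4 → Fin 4 → ℝ) (hC : IsWeyl C) (l m : Fin 4) :
    (∑ r, ∑ t, ∑ s, sgn r * sgn t * sgn s * C r t l s * C r t m s) = contr C l m := by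
  have pair := hC.2.2.1
  calc _ = ∑ r, ∑ s, ∑ t, sgn r * sgn t * sgn s * C r t l s * C r t m s :=
        Finset.sum_congr rfl fun r _ => Finset.sum_comm
    _ = ∑ s, ∑ r, ∑ t, sgn r * sgn t * sgn s * C r t l s * C r t m s := Finset.sum_comm
    _ = contr C l m := by
        refine Finset.sum_congr rfl fun s _ => Finset.sum_congr rfl fun r _ =>
          Finset.sum_congr rfl fun t _ => ?_
        rw [pair r t l s, pair r t m s]
        ring

/-- in dimension n = 4 the superenergy tensor reduces to the
Bel–Robinson form. -/
theorem stmt_6 (C : Fin 4 → Fin 4 → Fin 4 → Fin 4 → ℝ) (hC : IsWeyl C) :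
    ∀ a b l m : Fin 4,
      SE C a b l m =
        (∑ r, ∑ s, sgn r * sgn s * (C a r l s * C b r m s + C a r m s * C b r l s))
        - (1/8) * eta a b * eta l m *
            (∑ r, ∑ t, ∑ s, ∑ v, sgn r * sgn t * sgn s * sgn v * C r t s v * C r t s v) := by
  intro a b l m
  rw [SE, sum_pair_eq_contr C hC, sum_sq_eq C hC, ← contr, contr_eq_eta_mul C hC l m,
    contr_eq_eta_mul C hC a b]
  ring
end
end

section
/- Let C be a Weyl candidate on n-dimensional Minkowski vector space with superenergy tensor 𝒯. Then 𝒯 satisfies the dominant property: 𝒯_{αβλμ} v₁^α v₂^β v₃^λ v₄^μ ≥ 0 for any four future-pointing vectors v₁, v₂, v₃, v₄. -/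
open Finset

noncomputable section

/-- A positive semidefinite symmetric bilinear form is a nonnegative combination of squares of
linear forms. -/
theorem exists_sum_squares {V : Type*} [AddCommGroup V] [Module ℝ V] [FiniteDimensional ℝ V]
    (B : LinearMap.BilinForm ℝ V) (hs : ∀ x y, B x y = B y x) (hp : ∀ x, 0 ≤ B x x) :
    ∃ (m : ℕ) (w : Fin m → ℝ) (f : Fin m → V →ₗ[ℝ] ℝ), (∀ k, 0 ≤ w k) ∧
      ∀ x y, B x y = ∑ k, w k * (f k x * f k y) := by
  have : Invertible (2 : ℝ) := invertibleOfNonzero two_ne_zero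
  obtain ⟨v, hv⟩ := LinearMap.BilinForm.exists_orthogonal_basis (B := B) ⟨hs⟩
  refine ⟨_, fun k => B (v k) (v k), fun k => v.coord k, fun k => hp _, fun x y => ?_⟩
  conv_lhs => rw [← v.sum_repr x, ← v.sum_repr y]
  simp only [map_sum, LinearMap.sum_apply, map_smul, LinearMap.smul_apply, smul_eq_mul,
    Module.Basis.coord_apply]
  refine sum_congr rfl fun k _ => ?_
  rw [sum_eq_single k]
  · ring
  · intro j _ hj
    have : B (v j) (v k) = 0 := hv hj
    rw [hs] at this
    simp [hs, this]
  · simp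

/-- The Minkowski inner product. -/
def mip {n : ℕ} (x y : Fin n → ℝ) : ℝ := ∑ i, sgn i * x i * y i

theorem mip_comm {n : ℕ} (x y : Fin n → ℝ) : mip x y = mip y x :=
  sum_congr rfl fun _ _ => by ring

theorem mip_add_left {n : ℕ} (x y z : Fin n → ℝ) : mip (x + y) z = mip x z + mip y z := by
  simp only [mip, ← sum_add_distrib, Pi.add_apply]
  exact sum_congr rfl fun _ _ => by ring

theorem mip_smul_left {n : ℕ} (c : ℝ) (x z : Fin n → ℝ) : mip (c • x) z = c * mip x z := by
  simp only [mip, mul_sum, Pi.smul_apply, smul_eq_mul]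
  exact sum_congr rfl fun _ _ => by ring

theorem mip_add_right {n : ℕ} (x y z : Fin n → ℝ) : mip z (x + y) = mip z x + mip z y := by
  simp only [mip_comm z, mip_add_left]

theorem mip_smul_right {n : ℕ} (c : ℝ) (x z : Fin n → ℝ) : mip z (c • x) = c * mip z x := by
  simp only [mip_comm z, mip_smul_left]

theorem mip_lo_lo {n : ℕ} (x y : Fin n → ℝ) : mip (lo x) (lo y) = mip x y :=
  sum_congr rfl fun i _ => by
    unfold lo; linear_combination (sgn i * x i * y i) * sgn_mul_self i

theorem mip_lo_right {n : ℕ} (x y : Fin n → ℝ) : mip x (lo y) = x ⬝ᵥ y :=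
  sum_congr rfl fun i _ => by
    unfold lo; linear_combination (x i * y i) * sgn_mul_self i

theorem lo_dotProduct {n : ℕ} (x y : Fin n → ℝ) : lo x ⬝ᵥ y = mip x y := rfl

theorem mip_succ {m : ℕ} (x y : Fin (m + 1) → ℝ) :
    mip x y = - (x 0 * y 0) + ∑ i : Fin m, x i.succ * y i.succ := by
  simp [mip, Fin.sum_univ_succ, sgn]

/-- A covector annihilating a future causal vector is spacelike or null. -/
theorem mip_self_nonneg_of_dotProduct_eq_zero {m : ℕ} {k x : Fin (m + 1) → ℝ} (h0 : 0 < k 0)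
    (hk : mip k k ≤ 0) (hx : x ⬝ᵥ k = 0) : 0 ≤ mip x x := by
  rw [mip_succ] at hk ⊢
  have hx' : x 0 * k 0 + ∑ i : Fin m, x i.succ * k i.succ = 0 := by
    rw [← hx, dotProduct, Fin.sum_univ_succ]
  have cs := sum_mul_sq_le_sq_mul_sq univ (fun i : Fin m => x i.succ) (fun i => k i.succ)
  simp only [pow_two] at cs
  have hX : 0 ≤ ∑ i : Fin m, x i.succ * x i.succ := sum_nonneg fun _ _ => mul_self_nonneg _
  have h2 := mul_le_mul_of_nonneg_left hk hX
  have e : ∑ i : Fin m, x i.succ * k i.succ = -(x 0 * k 0) := by linarith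
  rw [e] at cs
  by_contra! hneg
  nlinarith [mul_pos h0 h0]

/-- For null `k`, `l` this is, up to scale, the inverse metric projected orthogonally to both. -/
theorem screen_nonneg {m : ℕ} {k l : Fin (m + 1) → ℝ} (h0 : 0 < k 0) (hk : mip k k = 0)
    (hl : mip l l = 0) {s : ℝ} (hs : 0 < s) (hkl : mip k l = -s) (w : Fin (m + 1) → ℝ) :
    0 ≤ mip w w + s⁻¹ * ((w ⬝ᵥ k) * (w ⬝ᵥ l) + (w ⬝ᵥ l) * (w ⬝ᵥ k)) := by
  have key := mip_self_nonneg_of_dotProduct_eq_zero (k := k)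
    (x := w + (s⁻¹ * (w ⬝ᵥ l)) • lo k + (s⁻¹ * (w ⬝ᵥ k)) • lo l) h0 hk.le (by
      simp only [add_dotProduct, smul_dotProduct, lo_dotProduct, hk, mip_comm l k, hkl, smul_eq_mul]
      field_simp; ring)
  convert key using 1
  simp only [mip_add_left, mip_add_right, mip_smul_left, mip_smul_right, mip_lo_lo,
    mip_comm (lo _) w, mip_lo_right w, hk, hl, mip_comm l k, hkl]
  field_simp; ring

/-- Contraction of a two-index array with a vector in its first slot. -/
def contract {n : ℕ} (u : Fin n → ℝ) (F : Fin n → Fin n → ℝ) (r : Fin n) : ℝ := ∑ a, u a * F a r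

/-- Full Minkowski contraction of two-index arrays. -/
def mip₂ {n : ℕ} (F G : Fin n → Fin n → ℝ) : ℝ := ∑ r, ∑ t, sgn r * sgn t * F r t * G r t

/-- Polarized stress tensor of a 2-form, contracted with `u` and `v`. -/
def energy {n : ℕ} (u v : Fin n → ℝ) (F G : Fin n → Fin n → ℝ) : ℝ :=
  1 / 2 * (mip (contract u F) (contract v G) + mip (contract v F) (contract u G))
    - 1 / 4 * mip u v * mip₂ F G

section linearity
variable {n : ℕ}

theorem contract_add_left (u v : Fin n → ℝ) (F : Fin n → Fin n → ℝ) :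
    contract (u + v) F = contract u F + contract v F := by
  ext r; simp [contract, add_mul, sum_add_distrib]

theorem contract_smul_left (c : ℝ) (u : Fin n → ℝ) (F : Fin n → Fin n → ℝ) :
    contract (c • u) F = c • contract u F := by
  ext r; simp [contract, mul_sum, mul_assoc]

theorem contract_add_right (u : Fin n → ℝ) (F G : Fin n → Fin n → ℝ) :
    contract u (F + G) = contract u F + contract u G := by
  ext r; simp [contract, mul_add, sum_add_distrib]

theorem contract_smul_right (c : ℝ) (u : Fin n → ℝ) (F : Fin n → Fin n → ℝ) :
    contract u (c • F) = c • contract u F := by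
  ext r; simp [contract, mul_sum, mul_left_comm]

theorem mip₂_comm (F G : Fin n → Fin n → ℝ) : mip₂ F G = mip₂ G F :=
  sum_congr rfl fun _ _ => sum_congr rfl fun _ _ => by ring

theorem mip₂_add_left (F F' G : Fin n → Fin n → ℝ) : mip₂ (F + F') G = mip₂ F G + mip₂ F' G := by
  simp only [mip₂, ← sum_add_distrib, Pi.add_apply]
  exact sum_congr rfl fun _ _ => sum_congr rfl fun _ _ => by ring

theorem mip₂_smul_left (c : ℝ) (F G : Fin n → Fin n → ℝ) : mip₂ (c • F) G = c * mip₂ F G := by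
  simp only [mip₂, mul_sum, Pi.smul_apply, smul_eq_mul]
  exact sum_congr rfl fun _ _ => sum_congr rfl fun _ _ => by ring

theorem energy_swap (u v : Fin n → ℝ) (F G : Fin n → Fin n → ℝ) :
    energy u v F G = energy v u F G := by
  simp only [energy, mip_comm u v]; ring

theorem energy_comm (u v : Fin n → ℝ) (F G : Fin n → Fin n → ℝ) :
    energy u v F G = energy u v G F := by
  simp only [energy, mip₂_comm F G, mip_comm (contract _ F)]; ring

theorem energy_add_left (u u' v : Fin n → ℝ) (F G : Fin n → Fin n → ℝ) :
    energy (u + u') v F G = energy u v F G + energy u' v F G := by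
  simp only [energy, contract_add_left, mip_add_left, mip_add_right]; ring

theorem energy_smul_left (c : ℝ) (u v : Fin n → ℝ) (F G : Fin n → Fin n → ℝ) :
    energy (c • u) v F G = c * energy u v F G := by
  simp only [energy, contract_smul_left, mip_smul_left, mip_smul_right]; ring

theorem energy_add_form (u v : Fin n → ℝ) (F F' G : Fin n → Fin n → ℝ) :
    energy u v (F + F') G = energy u v F G + energy u v F' G := by
  simp only [energy, contract_add_right, mip_add_left, mip₂_add_left]; ring

theorem energy_smul_form (c : ℝ) (u v : Fin n → ℝ) (F G : Fin n → Fin n → ℝ) :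
    energy u v (c • F) G = c * energy u v F G := by
  simp only [energy, contract_smul_right, mip_smul_left, mip₂_smul_left]; ring

end linearity

theorem contract_dotProduct_swap {n : ℕ} {F : Fin n → Fin n → ℝ} (hF : ∀ a b, F b a = - F a b)
    (u v : Fin n → ℝ) : contract u F ⬝ᵥ v = - (contract v F ⬝ᵥ u) := by
  simp only [dotProduct, contract, sum_mul, ← sum_neg_distrib]
  rw [sum_comm]
  exact sum_congr rfl fun a _ => sum_congr rfl fun b _ => by rw [hF a b]; ring

theorem contract_dotProduct_self {n : ℕ} {F : Fin n → Fin n → ℝ} (hF : ∀ a b, F b a = - F a b)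
    (u : Fin n → ℝ) : contract u F ⬝ᵥ u = 0 := by
  linarith [contract_dotProduct_swap hF u u]

/-- The screen form as a bilinear form on covectors. -/
def screenForm {n : ℕ} (k l : Fin n → ℝ) (c : ℝ) : LinearMap.BilinForm ℝ (Fin n → ℝ) :=
  LinearMap.mk₂ ℝ (fun x y => mip x y + c * ((x ⬝ᵥ k) * (y ⬝ᵥ l) + (x ⬝ᵥ l) * (y ⬝ᵥ k)))
    (fun x x' y => by simp only [mip_add_left, add_dotProduct]; ring)
    (fun c x y => by simp only [mip_smul_left, smul_dotProduct, smul_eq_mul]; ring)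
    (fun x y y' => by simp only [mip_add_right, add_dotProduct]; ring)
    (fun c x y => by simp only [mip_smul_right, smul_dotProduct, smul_eq_mul]; ring)

theorem screenForm_apply {n : ℕ} (k l : Fin n → ℝ) (c : ℝ) (x y : Fin n → ℝ) :
    screenForm k l c x y = mip x y + c * ((x ⬝ᵥ k) * (y ⬝ᵥ l) + (x ⬝ᵥ l) * (y ⬝ᵥ k)) := rfl

theorem energy_nonneg_of_null_of_mip_neg {m : ℕ} {k l : Fin (m + 1) → ℝ} (h0 : 0 < k 0)
    (hk : mip k k = 0) (hl : mip l l = 0) (hkl : mip k l < 0) {F : Fin (m + 1) → Fin (m + 1) → ℝ}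
    (hF : ∀ a b, F b a = - F a b) : 0 ≤ energy k l F F := by
  obtain ⟨s, hs⟩ : ∃ s, mip k l = -s := ⟨- mip k l, by ring⟩
  have hs0 : 0 < s := by linarith
  have hpos : ∀ x, 0 ≤ screenForm k l s⁻¹ x x := fun x => screen_nonneg h0 hk hl hs0 hs x
  obtain ⟨N, w, f, hw, hf⟩ := exists_sum_squares (screenForm k l s⁻¹)
    (fun x y => by simp only [screenForm_apply, mip_comm x y]; ring) hpos
  have hsum : 0 ≤ ∑ j, w j * screenForm k l s⁻¹ (fun b => f j (F b)) (fun b => f j (F b)) :=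
    sum_nonneg fun j _ => mul_nonneg (hw j) (hpos _)
  have hdot : ∀ j (u : Fin (m + 1) → ℝ), (fun b => f j (F b)) ⬝ᵥ u = f j (contract u F) := by
    intro j u
    have : contract u F = ∑ b, u b • F b := by ext r; simp [contract]
    rw [this, map_sum]
    simp [dotProduct, mul_comm]
  have hFu : ∀ (u : Fin (m + 1) → ℝ) b, F b ⬝ᵥ u = - contract u F b := by
    intro u b
    simp only [dotProduct, contract, ← sum_neg_distrib]
    exact sum_congr rfl fun a _ => by rw [hF a b]; ring
  have h1 : ∑ j, w j * screenForm k l s⁻¹ (fun b => f j (F b)) (fun b => f j (F b))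
      = ∑ b, sgn b * screenForm k l s⁻¹ (F b) (F b)
        + 2 * s⁻¹ * screenForm k l s⁻¹ (contract k F) (contract l F) := by
    have hg : ∀ j, screenForm k l s⁻¹ (fun b => f j (F b)) (fun b => f j (F b))
        = mip (fun b => f j (F b)) (fun b => f j (F b))
          + 2 * s⁻¹ * (f j (contract k F) * f j (contract l F)) := by
      intro j; rw [screenForm_apply, hdot, hdot]; ring
    simp only [hg]
    simp only [hf, mip, mul_sum, mul_add, sum_add_distrib]
    rw [sum_comm]
    congr 1
    · exact sum_congr rfl fun _ _ => sum_congr rfl fun _ _ => by ring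
    · exact sum_congr rfl fun _ _ => by ring
  have h2 : ∑ b, sgn b * screenForm k l s⁻¹ (F b) (F b)
      = mip₂ F F + 2 * s⁻¹ * mip (contract k F) (contract l F) := by
    have hg : ∀ b, screenForm k l s⁻¹ (F b) (F b)
        = mip (F b) (F b) + 2 * s⁻¹ * (contract k F b * contract l F b) := by
      intro b; rw [screenForm_apply, hFu, hFu]; ring
    simp only [hg, mip₂, mip, mul_sum, mul_add, sum_add_distrib]
    congr 1
    · exact sum_congr rfl fun _ _ => sum_congr rfl fun _ _ => by ring
    · exact sum_congr rfl fun _ _ => by ring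
  rw [h1, h2, screenForm_apply, contract_dotProduct_self hF, contract_dotProduct_self hF,
    contract_dotProduct_swap hF l k] at hsum
  have h3 : energy k l F F = s / 4 * (mip₂ F F + 2 * s⁻¹ * mip (contract k F) (contract l F)
      + 2 * s⁻¹ * (mip (contract k F) (contract l F)
        + s⁻¹ * (0 * 0 + contract k F ⬝ᵥ l * -(contract k F ⬝ᵥ l))))
      + (contract k F ⬝ᵥ l) ^ 2 / (2 * s) := by
    rw [energy, hs, mip_comm (contract l F)]
    field_simp
    ring
  rw [h3]
  positivity

theorem energy_nonneg_of_null {m : ℕ} {k l : Fin (m + 1) → ℝ} (hk0 : k 0 = 1) (hl0 : l 0 = 1)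
    (hk : mip k k = 0) (hl : mip l l = 0) {F : Fin (m + 1) → Fin (m + 1) → ℝ}
    (hF : ∀ a b, F b a = - F a b) : 0 ≤ energy k l F F := by
  have hsq : mip (k + (-1 : ℝ) • l) (k + (-1 : ℝ) • l) = -2 * mip k l := by
    simp only [mip_add_left, mip_add_right, mip_smul_left, mip_smul_right, hk, hl, mip_comm l k]
    ring
  have hsq' : mip (k + (-1 : ℝ) • l) (k + (-1 : ℝ) • l)
      = ∑ i : Fin m, (k i.succ - l i.succ) * (k i.succ - l i.succ) := by
    rw [mip_succ]
    simp [hk0, hl0, sub_eq_add_neg]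
  have hnn : 0 ≤ ∑ i : Fin m, (k i.succ - l i.succ) * (k i.succ - l i.succ) :=
    sum_nonneg fun _ _ => mul_self_nonneg _
  rcases lt_or_eq_of_le (show mip k l ≤ 0 by linarith) with h | h
  · exact energy_nonneg_of_null_of_mip_neg (by simp [hk0]) hk hl h hF
  · have hz : ∑ i : Fin m, (k i.succ - l i.succ) * (k i.succ - l i.succ) = 0 := by linarith
    rw [sum_eq_zero_iff_of_nonneg fun _ _ => mul_self_nonneg _] at hz
    have hkl : k = l := by
      ext i
      refine Fin.cases (hk0.trans hl0.symm) (fun i => ?_) i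
      exact sub_eq_zero.mp (mul_self_eq_zero.mp (hz i (mem_univ i)))
    subst hkl
    have := mip_self_nonneg_of_dotProduct_eq_zero (by simp [hk0]) hk.le
      (contract_dotProduct_self hF k)
    rw [energy, hk]
    linarith

/-- A future causal vector is a nonnegative combination of two normalized null vectors. -/
theorem exists_null_decomposition {m : ℕ} {u : Fin (m + 2) → ℝ} (h0 : 0 < u 0)
    (hu : mip u u ≤ 0) : ∃ (k k' : Fin (m + 2) → ℝ) (α β : ℝ), k 0 = 1 ∧ k' 0 = 1 ∧ mip k k = 0 ∧
      mip k' k' = 0 ∧ 0 ≤ α ∧ 0 ≤ β ∧ u = α • k + β • k' := by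
  obtain ⟨p, r, hp, hr, hup⟩ : ∃ (p : Fin (m + 1) → ℝ) (r : ℝ), ∑ i, p i * p i = 1 ∧ 0 ≤ r ∧
      ∀ i, u i.succ = r * p i := by
    set R := ∑ i : Fin (m + 1), u i.succ * u i.succ with hR
    have hR0 : 0 ≤ R := sum_nonneg fun _ _ => mul_self_nonneg _
    rcases eq_or_lt_of_le hR0 with h | h
    · refine ⟨Pi.single 0 1, 0, by simp [Pi.single_apply], le_rfl, fun i => ?_⟩
      have hz := h.symm
      rw [hR, sum_eq_zero_iff_of_nonneg fun _ _ => mul_self_nonneg _] at hz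
      rw [zero_mul]
      exact mul_self_eq_zero.mp (hz i (mem_univ i))
    · have hs : 0 < √R := Real.sqrt_pos.mpr h
      refine ⟨fun i => u i.succ / √R, √R, ?_, hs.le, fun i => by field_simp⟩
      simp only [div_mul_div_comm, Real.mul_self_sqrt hR0, ← sum_div]
      exact div_self h.ne'
  have hru : r ≤ u 0 := by
    rw [mip_succ] at hu
    have : ∑ i : Fin (m + 1), u i.succ * u i.succ = r * r := by
      rw [← mul_one (r * r), ← hp, mul_sum]
      exact sum_congr rfl fun i _ => by rw [hup]; ring
    rw [this] at hu
    nlinarith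
  refine ⟨Fin.cons 1 p, Fin.cons 1 (-p), (u 0 + r) / 2, (u 0 - r) / 2, rfl, rfl, ?_, ?_,
    by linarith, by linarith, ?_⟩
  · simp [mip_succ, hp]
  · simp [mip_succ, hp]
  · ext i
    refine Fin.cases ?_ (fun i => ?_) i
    · simp; ring
    · simp [hup]; ring

/-- The dominant energy condition for 2-forms. -/
theorem energy_nonneg {m : ℕ} {u v : Fin (m + 2) → ℝ} (hu0 : 0 < u 0) (hu : mip u u ≤ 0)
    (hv0 : 0 < v 0) (hv : mip v v ≤ 0) {F : Fin (m + 2) → Fin (m + 2) → ℝ}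
    (hF : ∀ a b, F b a = - F a b) : 0 ≤ energy u v F F := by
  obtain ⟨k, k', α, β, hk0, hk0', hk, hk', hα, hβ, rfl⟩ := exists_null_decomposition hu0 hu
  obtain ⟨l, l', γ, δ, hl0, hl0', hl, hl', hγ, hδ, rfl⟩ := exists_null_decomposition hv0 hv
  have h₁ := energy_nonneg_of_null hl0 hk0 hl hk hF
  have h₂ := energy_nonneg_of_null hl0 hk0' hl hk' hF
  have h₃ := energy_nonneg_of_null hl0' hk0 hl' hk hF
  have h₄ := energy_nonneg_of_null hl0' hk0' hl' hk' hF
  simp only [energy_add_left, energy_smul_left, energy_swap k, energy_swap k']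
  positivity

/-- The space of skew two-index arrays. -/
def skewArrays (n : ℕ) : Submodule ℝ (Fin n → Fin n → ℝ) where
  carrier := {F | ∀ a b, F b a = - F a b}
  add_mem' {F G} hF hG a b := by simp [hF a b, hG a b, add_comm]
  zero_mem' a b := by simp
  smul_mem' c F hF a b := by simp [hF a b]

/-- `energy u v` as a bilinear form on skew arrays. -/
def energyForm {n : ℕ} (u v : Fin n → ℝ) : LinearMap.BilinForm ℝ (skewArrays n) :=
  LinearMap.mk₂ ℝ (fun F G => energy u v F G)
    (fun F F' G => energy_add_form u v F F' G)
    (fun c F G => energy_smul_form c u v F G)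
    (fun F G G' => by
      simp only [energy_comm u v (F : Fin n → Fin n → ℝ)]; exact energy_add_form u v G G' F)
    (fun c F G => by
      simp only [energy_comm u v (F : Fin n → Fin n → ℝ)]; exact energy_smul_form c u v G F)

theorem sum_eta {n : ℕ} (u v : Fin n → ℝ) : ∑ a, ∑ b, eta a b * u a * v b = mip u v := by
  simp [mip, eta]

/-- Polarized stress tensor of a 2-form. -/
def stress {n : ℕ} (F G : Fin n → Fin n → ℝ) (a b : Fin n) : ℝ :=
  1 / 2 * (∑ r, sgn r * (F a r * G b r + F b r * G a r)) - 1 / 4 * eta a b * mip₂ F G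

theorem energy_eq_sum {n : ℕ} (u v : Fin n → ℝ) (F G : Fin n → Fin n → ℝ) :
    energy u v F G = ∑ a, ∑ b, stress F G a b * u a * v b := by
  have h : ∀ F G : Fin n → Fin n → ℝ, mip (contract u F) (contract v G)
      = ∑ a, ∑ b, (∑ r, sgn r * (F a r * G b r)) * u a * v b := by
    intro F G
    symm
    simp only [sum_mul]
    rw [sum_congr rfl fun a _ => sum_comm, sum_comm]
    refine sum_congr rfl fun r _ => ?_
    rw [mul_assoc, contract, contract, sum_mul_sum, mul_sum]
    refine sum_congr rfl fun a _ => ?_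
    rw [mul_sum]
    exact sum_congr rfl fun b _ => by ring
  rw [energy, mip_comm (contract v F), h F G, h G F, ← sum_eta, mul_add, mul_sum, mul_sum, mul_sum,
    sum_mul, ← sum_add_distrib, ← sum_sub_distrib]
  refine sum_congr rfl fun a _ => ?_
  rw [mul_sum, mul_sum, mul_sum, sum_mul, ← sum_add_distrib, ← sum_sub_distrib]
  refine sum_congr rfl fun b _ => ?_
  have hr : ∑ r, sgn r * (F a r * G b r + F b r * G a r)
      = ∑ r, sgn r * (F a r * G b r) + ∑ r, sgn r * (G a r * F b r) := by
    rw [← sum_add_distrib]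
    exact sum_congr rfl fun _ _ => by ring
  rw [stress, hr]
  ring

/-- The 2-form obtained by fixing the second index pair. -/
def pairSlice {n : ℕ} (C : Fin n → Fin n → Fin n → Fin n → ℝ) (l m : Fin n) : Fin n → Fin n → ℝ :=
  fun a b => C a b l m

/-- The superenergy tensor is the stress tensor applied to both index pairs. -/
theorem SE_eq_stress {n : ℕ} (C : Fin n → Fin n → Fin n → Fin n → ℝ) (a b l m : Fin n) :
    SE C a b l m = 2 * (∑ s, sgn s * stress (pairSlice C l s) (pairSlice C m s) a b
      - 1 / 4 * eta l m * ∑ t, ∑ s, sgn t * sgn s * stress (pairSlice C t s) (pairSlice C t s) a b) := by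
  have h₁ : ∑ r, ∑ s, sgn r * sgn s * (C a r l s * C b r m s + C a r m s * C b r l s)
      = ∑ s, sgn s * ∑ r, sgn r * (C a r l s * C b r m s + C b r l s * C a r m s) := by
    rw [sum_comm]
    refine sum_congr rfl fun s _ => ?_
    rw [mul_sum]
    exact sum_congr rfl fun _ _ => by ring
  have h₂ : ∑ r, ∑ t, ∑ s, sgn r * sgn t * sgn s * C r t l s * C r t m s
      = ∑ s, sgn s * mip₂ (pairSlice C l s) (pairSlice C m s) := by
    rw [sum_congr rfl fun r _ => sum_comm, sum_comm]
    refine sum_congr rfl fun s _ => ?_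
    simp only [mip₂, mul_sum, pairSlice]
    exact sum_congr rfl fun _ _ => sum_congr rfl fun _ _ => by ring
  have h₃ : ∑ r, ∑ s, ∑ t, sgn r * sgn s * sgn t * C a r s t * C b r s t
      = ∑ t, ∑ s, sgn t * sgn s * ∑ r, sgn r * (C a r t s * C b r t s) := by
    rw [sum_comm]
    refine sum_congr rfl fun t _ => ?_
    rw [sum_comm]
    refine sum_congr rfl fun s _ => ?_
    rw [mul_sum]
    exact sum_congr rfl fun _ _ => by ring
  have h₄ : ∑ r, ∑ t, ∑ s, ∑ v, sgn r * sgn t * sgn s * sgn v * C r t s v * C r t s v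
      = ∑ t, ∑ s, sgn t * sgn s * mip₂ (pairSlice C t s) (pairSlice C t s) := by
    rw [sum_congr rfl fun r _ => sum_comm, sum_comm]
    refine sum_congr rfl fun t _ => ?_
    rw [sum_congr rfl fun r _ => sum_comm, sum_comm]
    refine sum_congr rfl fun s _ => ?_
    simp only [mip₂, mul_sum, pairSlice]
    exact sum_congr rfl fun _ _ => sum_congr rfl fun _ _ => by ring
  have h₅ : ∑ s, sgn s * stress (pairSlice C l s) (pairSlice C m s) a b
      = 1 / 2 * (∑ s, sgn s * ∑ r, sgn r * (C a r l s * C b r m s + C b r l s * C a r m s))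
        - 1 / 4 * eta a b * ∑ s, sgn s * mip₂ (pairSlice C l s) (pairSlice C m s) := by
    rw [mul_sum, mul_sum, ← sum_sub_distrib]
    exact sum_congr rfl fun s _ => by simp only [stress, pairSlice]; ring
  have h₆ : ∑ t, ∑ s, sgn t * sgn s * stress (pairSlice C t s) (pairSlice C t s) a b
      = (∑ t, ∑ s, sgn t * sgn s * ∑ r, sgn r * (C a r t s * C b r t s))
        - 1 / 4 * eta a b * ∑ t, ∑ s, sgn t * sgn s * mip₂ (pairSlice C t s) (pairSlice C t s) := by
    rw [mul_sum, ← sum_sub_distrib]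
    refine sum_congr rfl fun t _ => ?_
    rw [mul_sum, ← sum_sub_distrib]
    refine sum_congr rfl fun s _ => ?_
    have : ∑ r, sgn r * (C a r t s * C b r t s + C b r t s * C a r t s)
        = 2 * ∑ r, sgn r * (C a r t s * C b r t s) := by
      rw [mul_sum]
      exact sum_congr rfl fun _ _ => by ring
    simp only [stress, pairSlice, this]
    ring
  rw [SE, h₁, h₂, h₃, h₄, h₅, h₆]
  ring

theorem sum_SE_eq_sum_energy {n : ℕ} (C : Fin n → Fin n → Fin n → Fin n → ℝ)
    (v₁ v₂ v₃ v₄ : Fin n → ℝ) :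
    ∑ a, ∑ b, ∑ l, ∑ m, SE C a b l m * v₁ a * v₂ b * v₃ l * v₄ m
      = 2 * ∑ l, ∑ m, (∑ s, sgn s * energy v₁ v₂ (pairSlice C l s) (pairSlice C m s)
        - 1 / 4 * eta l m * ∑ t, ∑ s, sgn t * sgn s *
          energy v₁ v₂ (pairSlice C t s) (pairSlice C t s)) * v₃ l * v₄ m := by
  have hlin : ∀ l m, (∑ a, ∑ b, SE C a b l m * v₁ a * v₂ b)
      = 2 * (∑ s, sgn s * energy v₁ v₂ (pairSlice C l s) (pairSlice C m s)
        - 1 / 4 * eta l m * ∑ t, ∑ s, sgn t * sgn s *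
          energy v₁ v₂ (pairSlice C t s) (pairSlice C t s)) := by
    intro l m
    have hl : ∑ s, sgn s * energy v₁ v₂ (pairSlice C l s) (pairSlice C m s)
        = ∑ a, ∑ b, (∑ s, sgn s * stress (pairSlice C l s) (pairSlice C m s) a b) * v₁ a * v₂ b := by
      simp only [energy_eq_sum, mul_sum, sum_mul]
      rw [sum_comm]
      refine sum_congr rfl fun a _ => ?_
      rw [sum_comm]
      exact sum_congr rfl fun b _ => sum_congr rfl fun s _ => by ring
    have ht : ∑ t, ∑ s, sgn t * sgn s * energy v₁ v₂ (pairSlice C t s) (pairSlice C t s)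
        = ∑ a, ∑ b, (∑ t, ∑ s, sgn t * sgn s * stress (pairSlice C t s) (pairSlice C t s) a b)
          * v₁ a * v₂ b := by
      simp only [energy_eq_sum, mul_sum, sum_mul]
      rw [sum_congr rfl fun t _ => sum_comm, sum_comm]
      refine sum_congr rfl fun a _ => ?_
      rw [sum_congr rfl fun t _ => sum_comm, sum_comm]
      exact sum_congr rfl fun b _ => sum_congr rfl fun t _ => sum_congr rfl fun s _ => by ring
    rw [hl, ht, mul_sum, ← sum_sub_distrib, mul_sum]
    refine sum_congr rfl fun a _ => ?_
    rw [mul_sum, ← sum_sub_distrib, mul_sum]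
    exact sum_congr rfl fun b _ => by rw [SE_eq_stress]; ring
  rw [sum_congr rfl fun a _ => sum_comm, sum_comm, mul_sum]
  refine sum_congr rfl fun l _ => ?_
  rw [sum_congr rfl fun a _ => sum_comm, sum_comm, mul_sum]
  refine sum_congr rfl fun m _ => ?_
  rw [← mul_assoc, ← mul_assoc, ← hlin]
  simp only [sum_mul]

theorem pairSlice_mem_skewArrays {n : ℕ} {C : Fin n → Fin n → Fin n → Fin n → ℝ}
    (hC : ∀ a b l m, C b a l m = - C a b l m) (l m : Fin n) : pairSlice C l m ∈ skewArrays n :=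
  fun a b => hC a b l m

theorem sum_SE_nonneg {p : ℕ} {C : Fin (p + 2) → Fin (p + 2) → Fin (p + 2) → Fin (p + 2) → ℝ}
    (h₁₂ : ∀ a b l m, C b a l m = - C a b l m) (h₃₄ : ∀ a b l m, C a b m l = - C a b l m)
    {v₁ v₂ v₃ v₄ : Fin (p + 2) → ℝ} (p₁ : 0 < v₁ 0) (c₁ : mip v₁ v₁ ≤ 0) (p₂ : 0 < v₂ 0)
    (c₂ : mip v₂ v₂ ≤ 0) (p₃ : 0 < v₃ 0) (c₃ : mip v₃ v₃ ≤ 0) (p₄ : 0 < v₄ 0)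
    (c₄ : mip v₄ v₄ ≤ 0) :
    0 ≤ ∑ a, ∑ b, ∑ l, ∑ m, SE C a b l m * v₁ a * v₂ b * v₃ l * v₄ m := by
  obtain ⟨N, w, f, hw, hf⟩ := exists_sum_squares (energyForm v₁ v₂)
    (fun F G => energy_comm v₁ v₂ F G) (fun F => energy_nonneg p₁ c₁ p₂ c₂ F.2)
  let c (k : Fin N) (l m : Fin (p + 2)) : ℝ := f k ⟨pairSlice C l m, pairSlice_mem_skewArrays h₁₂ l m⟩
  have hE : ∀ l s m t, energy v₁ v₂ (pairSlice C l s) (pairSlice C m t) = ∑ k, w k * (c k l s * c k m t) :=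
    fun l s m t => hf ⟨pairSlice C l s, pairSlice_mem_skewArrays h₁₂ l s⟩
      ⟨pairSlice C m t, pairSlice_mem_skewArrays h₁₂ m t⟩
  have hc : ∀ k a b, c k b a = - c k a b := by
    intro k a b
    rw [← map_neg]
    exact congrArg (f k) (Subtype.ext (funext fun i => funext fun j => h₃₄ i j a b))
  have hst : ∀ l m, ∑ s, sgn s * energy v₁ v₂ (pairSlice C l s) (pairSlice C m s)
        - 1 / 4 * eta l m * ∑ t, ∑ s, sgn t * sgn s * energy v₁ v₂ (pairSlice C t s) (pairSlice C t s)
      = ∑ k, w k * stress (c k) (c k) l m := by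
    intro l m
    have h₁ : ∑ s, sgn s * energy v₁ v₂ (pairSlice C l s) (pairSlice C m s)
        = ∑ k, w k * (1 / 2 * ∑ r, sgn r * (c k l r * c k m r + c k m r * c k l r)) := by
      simp only [hE, mul_sum]
      rw [sum_comm]
      exact sum_congr rfl fun _ _ => sum_congr rfl fun _ _ => by ring
    have h₂ : ∑ t, ∑ s, sgn t * sgn s * energy v₁ v₂ (pairSlice C t s) (pairSlice C t s)
        = ∑ k, w k * mip₂ (c k) (c k) := by
      simp only [hE, mip₂, mul_sum]
      rw [sum_congr rfl fun t _ => sum_comm, sum_comm]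
      exact sum_congr rfl fun _ _ => sum_congr rfl fun _ _ => sum_congr rfl fun _ _ => by ring
    rw [h₁, h₂, mul_sum, ← sum_sub_distrib]
    exact sum_congr rfl fun k _ => by rw [stress]; ring
  have hsum : ∑ l, ∑ m, (∑ k, w k * stress (c k) (c k) l m) * v₃ l * v₄ m
      = ∑ k, w k * energy v₃ v₄ (c k) (c k) := by
    simp only [energy_eq_sum, mul_sum, sum_mul]
    rw [sum_congr rfl fun l _ => sum_comm, sum_comm]
    exact sum_congr rfl fun _ _ => sum_congr rfl fun _ _ => sum_congr rfl fun _ _ => by ring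
  simp only [sum_SE_eq_sum_energy, hst, hsum]
  exact mul_nonneg zero_le_two
    (sum_nonneg fun k _ => mul_nonneg (hw k) (energy_nonneg p₃ c₃ p₄ c₄ (hc k)))

/-- the dominant property of the superenergy tensor: its full
contraction with four future-pointing vectors is nonnegative. -/
theorem stmt_7 {n : ℕ} (hn : 2 ≤ n) (C : Fin n → Fin n → Fin n → Fin n → ℝ)
    (hC : IsWeyl C)
    (v₁ v₂ v₃ v₄ : Fin n → ℝ)
    (h₁ : v₁ ≠ 0 ∧ mSq v₁ ≤ 0 ∧ 0 < v₁ ⟨0, by omega⟩)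
    (h₂ : v₂ ≠ 0 ∧ mSq v₂ ≤ 0 ∧ 0 < v₂ ⟨0, by omega⟩)
    (h₃ : v₃ ≠ 0 ∧ mSq v₃ ≤ 0 ∧ 0 < v₃ ⟨0, by omega⟩)
    (h₄ : v₄ ≠ 0 ∧ mSq v₄ ≤ 0 ∧ 0 < v₄ ⟨0, by omega⟩) :
    0 ≤ ∑ a, ∑ b, ∑ l, ∑ m, SE C a b l m * v₁ a * v₂ b * v₃ l * v₄ m := by
  obtain ⟨p, rfl⟩ : ∃ p, n = p + 2 := ⟨n - 2, by omega⟩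
  exact sum_SE_nonneg hC.1 hC.2.1 h₁.2.2 h₁.2.1 h₂.2.2 h₂.2.1 h₃.2.2 h₃.2.1 h₄.2.2 h₄.2.1
end
end

section
/- Let C be a Weyl candidate on n-dimensional Minkowski vector space with superenergy tensor 𝒯, and let ℓ be a null vector. Then 𝒯_{αβλμ}ℓ^αℓ^βℓ^λℓ^μ = 2 S_{ρσ}S^{ρσ}, where S_{αβ} := C_{αρβσ}ℓ^ρℓ^σ and S^{ρσ} := η^{ρα}η^{σβ}S_{αβ}. -/
open Finset

noncomputable section

theorem sum_eta_mul {n : ℕ} (v : Fin n → ℝ) :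
    (∑ a, ∑ b, eta a b * v a * v b) = mSq v := by
  simp [eta, mSq, ite_mul, Finset.sum_ite_eq]

/-- A contraction `η_{ab} v^a v^b F_{lm} v^l v^m` vanishes for null `v`. -/
theorem sum_eta_mul_left_of_null {n : ℕ} {v : Fin n → ℝ} (hv : mSq v = 0)
    (F : Fin n → Fin n → ℝ) :
    (∑ a, ∑ b, ∑ l, ∑ m, eta a b * F l m * v a * v b * v l * v m) = 0 := by
  have h : (∑ a, ∑ b, ∑ l, ∑ m, eta a b * F l m * v a * v b * v l * v m) =
      (∑ a, ∑ b, eta a b * v a * v b) * ∑ l, ∑ m, F l m * v l * v m := by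
    simp only [Finset.sum_mul]
    simp only [Finset.mul_sum]
    refine sum_congr rfl fun a _ => sum_congr rfl fun b _ => sum_congr rfl fun l _ =>
      sum_congr rfl fun m _ => ?_
    ring
  rw [h, sum_eta_mul, hv, zero_mul]

/-- A contraction `F_{ab} v^a v^b η_{lm} v^l v^m` vanishes for null `v`. -/
theorem sum_eta_mul_right_of_null {n : ℕ} {v : Fin n → ℝ} (hv : mSq v = 0)
    (F : Fin n → Fin n → ℝ) :
    (∑ a, ∑ b, ∑ l, ∑ m, eta l m * F a b * v a * v b * v l * v m) = 0 := by
  refine sum_eq_zero fun a _ => sum_eq_zero fun b _ => ?_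
  have h : (∑ l, ∑ m, eta l m * F a b * v a * v b * v l * v m) =
      F a b * v a * v b * ∑ l, ∑ m, eta l m * v l * v m := by
    simp only [Finset.mul_sum]
    refine sum_congr rfl fun l _ => sum_congr rfl fun m _ => ?_
    ring
  rw [h, sum_eta_mul, hv, mul_zero]

/-- A fourfold sum of sums over two further indices, with the order of summation exchanged. -/
theorem sum_four_comm_two {n : ℕ} (G : Fin n → Fin n → Fin n → Fin n → Fin n → Fin n → ℝ) :
    (∑ a, ∑ b, ∑ l, ∑ m, ∑ r, ∑ s, G a b l m r s) =
      ∑ r, ∑ s, ∑ a, ∑ b, ∑ l, ∑ m, G a b l m r s := by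
  have h (H : Fin n → Fin n → Fin n → Fin n → Fin n → ℝ) :
      (∑ a, ∑ b, ∑ l, ∑ m, ∑ r, H a b l m r) = ∑ r, ∑ a, ∑ b, ∑ l, ∑ m, H a b l m r := by
    rw [sum_comm (s := univ (α := Fin n)) (t := univ (α := Fin n))
      (f := fun r a => ∑ b, ∑ l, ∑ m, H a b l m r)]
    refine sum_congr rfl fun a _ => ?_
    rw [sum_comm (f := fun r b => ∑ l, ∑ m, H a b l m r)]
    refine sum_congr rfl fun b _ => ?_
    rw [sum_comm (f := fun r l => ∑ m, H a b l m r)]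
    exact sum_congr rfl fun l _ => sum_comm
  rw [h]
  exact sum_congr rfl fun r _ => h _

/-- The quadratic part of the superenergy tensor contracts to twice the square of the
electric-type part of the curvature. -/
theorem sum_quadratic_part {n : ℕ} {C : Fin n → Fin n → Fin n → Fin n → ℝ} (hC : IsWeyl C)
    (v : Fin n → ℝ) :
    (∑ a, ∑ b, ∑ l, ∑ m,
      (∑ r, ∑ s, sgn r * sgn s * (C a r l s * C b r m s + C a r m s * C b r l s)) *
        v a * v b * v l * v m) =
      2 * ∑ r, ∑ s, sgn r * sgn s *
        (∑ p, ∑ q, C r p s q * v p * v q) * (∑ p, ∑ q, C r p s q * v p * v q) := by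
  obtain ⟨h₁, h₂, -, -, -⟩ := hC
  have hswap (a r l s : Fin n) : C r a s l = C a r l s := by rw [h₁, h₂, neg_neg]
  have hS (r s : Fin n) : (∑ p, ∑ q, C r p s q * v p * v q) =
      ∑ p, ∑ q, C p r q s * v p * v q :=
    sum_congr rfl fun p _ => sum_congr rfl fun q _ => by rw [hswap]
  have hmul (a b l m : Fin n) :
      (∑ r, ∑ s, sgn r * sgn s * (C a r l s * C b r m s + C a r m s * C b r l s)) *
        v a * v b * v l * v m =
      ∑ r, ∑ s, sgn r * sgn s * (C a r l s * C b r m s + C a r m s * C b r l s) *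
        v a * v b * v l * v m := by
    simp only [Finset.sum_mul]
  simp only [hmul]
  rw [sum_four_comm_two, Finset.mul_sum]
  refine sum_congr rfl fun r _ => ?_
  rw [Finset.mul_sum]
  refine sum_congr rfl fun s _ => ?_
  have hdirect : (∑ a, ∑ b, ∑ l, ∑ m, C a r l s * C b r m s * v a * v b * v l * v m) =
      (∑ p, ∑ q, C p r q s * v p * v q) * ∑ p, ∑ q, C p r q s * v p * v q := by
    simp only [sum_mul_sum]
    refine sum_congr rfl fun a _ => sum_congr rfl fun b _ => sum_congr rfl fun l _ =>
      sum_congr rfl fun m _ => ?_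
    ring
  have hcross : (∑ a, ∑ b, ∑ l, ∑ m, C a r m s * C b r l s * v a * v b * v l * v m) =
      (∑ p, ∑ q, C p r q s * v p * v q) * ∑ p, ∑ q, C p r q s * v p * v q := by
    rw [← hdirect]
    refine sum_congr rfl fun a _ => sum_congr rfl fun b _ => ?_
    rw [sum_comm]
    refine sum_congr rfl fun l _ => sum_congr rfl fun m _ => ?_
    ring
  calc _ = sgn r * sgn s *
        ((∑ a, ∑ b, ∑ l, ∑ m, C a r l s * C b r m s * v a * v b * v l * v m) +
          ∑ a, ∑ b, ∑ l, ∑ m, C a r m s * C b r l s * v a * v b * v l * v m) := by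
        simp only [← sum_add_distrib, Finset.mul_sum]
        refine sum_congr rfl fun a _ => sum_congr rfl fun b _ => sum_congr rfl fun l _ =>
          sum_congr rfl fun m _ => ?_
        ring
    _ = _ := by
        rw [hdirect, hcross, hS]
        ring

/-- for a null vector ℓ, the fourfold contraction of the
superenergy tensor equals 2 S_{ρσ}S^{ρσ}, where S_{αβ} := C_{αρβσ}ℓ^ρℓ^σ. -/
theorem stmt_10 {n : ℕ} (hn : 2 ≤ n) (C : Fin n → Fin n → Fin n → Fin n → ℝ)
    (hC : IsWeyl C)
    (ℓ : Fin n → ℝ) (hℓ0 : ℓ ≠ 0) (hnull : mSq ℓ = 0) :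
    (∑ a, ∑ b, ∑ l, ∑ m, SE C a b l m * ℓ a * ℓ b * ℓ l * ℓ m) =
      2 * ∑ r, ∑ s, sgn r * sgn s *
        (∑ p, ∑ q, C r p s q * ℓ p * ℓ q) * (∑ p, ∑ q, C r p s q * ℓ p * ℓ q) := by
  rw [← sum_quadratic_part hC ℓ]
  have hsplit (a b l m : Fin n) : SE C a b l m * ℓ a * ℓ b * ℓ l * ℓ m =
      (∑ r, ∑ s, sgn r * sgn s * (C a r l s * C b r m s + C a r m s * C b r l s)) *
        ℓ a * ℓ b * ℓ l * ℓ m +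
      eta a b * (-(1/2) * (∑ r, ∑ t, ∑ s, sgn r * sgn t * sgn s * C r t l s * C r t m s) +
        1/8 * eta l m * ∑ r, ∑ t, ∑ s, ∑ v,
          sgn r * sgn t * sgn s * sgn v * C r t s v * C r t s v) * ℓ a * ℓ b * ℓ l * ℓ m +
      eta l m * (-(1/2) * ∑ r, ∑ s, ∑ t, sgn r * sgn s * sgn t * C a r s t * C b r s t) *
        ℓ a * ℓ b * ℓ l * ℓ m := by
    rw [SE]
    ring
  simp only [hsplit, sum_add_distrib]
  rw [sum_eta_mul_left_of_null hnull fun l m =>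
      -(1/2) * (∑ r, ∑ t, ∑ s, sgn r * sgn t * sgn s * C r t l s * C r t m s) +
        1/8 * eta l m * ∑ r, ∑ t, ∑ s, ∑ v,
          sgn r * sgn t * sgn s * sgn v * C r t s v * C r t s v,
    sum_eta_mul_right_of_null hnull fun a b =>
      -(1/2) * ∑ r, ∑ s, ∑ t, sgn r * sgn s * sgn t * C a r s t * C b r s t,
    add_zero, add_zero]
end
end
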